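/- Let ω ⊂ ℝ^d be an open domain and k ≥ 2. Given v ∈ C²(ω, ℝ^k), w ∈ C¹(ω, ℝ^d), a ∈ C²(ω, ℝ), a unit vector η ∈ S^{d−1}, λ > 0 and two orthogonal unit vectors E₁, E₂ ∈ ℝ^k, define G(t) = sin t, Ḡ(t) = cos t, t_η = ⟨x, η⟩, and set ṽ(x) = v(x) + (1/λ)·a(x)·(G(λt_η)·E₁ + Ḡ(λt_η)·E₂) and w̃(x) = w(x) − (1/λ)·a(x)·(G(λt_η)·∇⟨v(x), E₁⟩ + Ḡ(λt_η)·∇⟨v(x), E₂⟩). Then (½(∇ṽ)ᵀ∇ṽ + sym∇w̃) − (½(∇v)ᵀ∇v + sym∇w) − ½a²·η⊗η = −(a/λ)·(G(λt_η)·∇²⟨v, E₁⟩ + Ḡ(λt_η)·∇²⟨v, E₂⟩) + (1/(2λ²))·∇a⊗∇a. -/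

import Mathlib

noncomputable section
open Real
open scoped BigOperators

/-- Partial derivative of `f` in the `i`-th coordinate direction. -/
def pd {d : ℕ} {E : Type*} [NormedAddCommGroup E] [NormedSpace ℝ E]
    (i : Fin d) (f : (Fin d → ℝ) → E) (x : Fin d → ℝ) : E :=
  fderiv ℝ f x (Pi.single i 1)

/-- The matrix `(∇v)ᵀ∇v`, with entries `⟨∂ᵢv, ∂ⱼv⟩`. -/
def gradTgrad {d k : ℕ} (v : (Fin d → ℝ) → Fin k → ℝ) (x : Fin d → ℝ) :
    Fin d → Fin d → ℝ :=
  fun i j => ∑ l, pd i (fun y => v y l) x * pd j (fun y => v y l) x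

/-- The symmetrized gradient `sym∇w = ½(∇w + (∇w)ᵀ)`. -/
def symGrad {d : ℕ} (w : (Fin d → ℝ) → Fin d → ℝ) (x : Fin d → ℝ) :
    Fin d → Fin d → ℝ :=
  fun i j => (pd i (fun y => w y j) x + pd j (fun y => w y i) x) / 2

theorem pd_add {d : ℕ} {x : Fin d → ℝ} {f g : (Fin d → ℝ) → ℝ} (i : Fin d)
    (hf : DifferentiableAt ℝ f x) (hg : DifferentiableAt ℝ g x) :
    pd i (fun y => f y + g y) x = pd i f x + pd i g x := by
  simp only [pd, fderiv_fun_add hf hg, add_apply]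

theorem pd_sub {d : ℕ} {x : Fin d → ℝ} {f g : (Fin d → ℝ) → ℝ} (i : Fin d)
    (hf : DifferentiableAt ℝ f x) (hg : DifferentiableAt ℝ g x) :
    pd i (fun y => f y - g y) x = pd i f x - pd i g x := by
  simp only [pd, fderiv_fun_sub hf hg, sub_apply]

theorem pd_const {d : ℕ} {x : Fin d → ℝ} (i : Fin d) (c : ℝ) :
    pd i (fun _ => c) x = 0 := by
  simp [pd]

theorem pd_sum_mul_const {d k : ℕ} {x : Fin d → ℝ} {v : (Fin d → ℝ) → Fin k → ℝ}
    (i : Fin d) (hv : ∀ l, DifferentiableAt ℝ (fun y => v y l) x) (E : Fin k → ℝ) :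
    pd i (fun y => ∑ l, v y l * E l) x = ∑ l, pd i (fun y => v y l) x * E l := by
  have h := HasFDerivAt.fun_sum (u := Finset.univ)
    fun l _ => (hv l).hasFDerivAt.mul_const (E l)
  simp [pd, h.fderiv, mul_comm]

theorem differentiableAt_pd {d : ℕ} {x : Fin d → ℝ} {f : (Fin d → ℝ) → ℝ} (i : Fin d)
    (hf : ContDiffAt ℝ 2 f x) : DifferentiableAt ℝ (pd i f) x :=
  ((hf.fderiv_right (m := 1) (by norm_num)).differentiableAt (by norm_num)).clm_apply
    (differentiableAt_const _)

theorem pd_comm {d : ℕ} {x : Fin d → ℝ} {f : (Fin d → ℝ) → ℝ} (i j : Fin d)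
    (hf : ContDiffAt ℝ 2 f x) : pd i (pd j f) x = pd j (pd i f) x := by
  have hd : DifferentiableAt ℝ (fderiv ℝ f) x :=
    (hf.fderiv_right (m := 1) (by norm_num)).differentiableAt (by norm_num)
  have key : ∀ a b : Fin d,
      pd a (pd b f) x = fderiv ℝ (fderiv ℝ f) x (Pi.single a 1) (Pi.single b 1) := by
    intro a b
    have h := hd.hasFDerivAt.clm_apply (hasFDerivAt_const (Pi.single b (1 : ℝ)) x)
    change fderiv ℝ (fun y => fderiv ℝ f y (Pi.single b 1)) x (Pi.single a 1) = _
    simp [h.fderiv]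
  rw [key, key]
  exact hf.isSymmSndFDerivAt (by simp) _ _

theorem hasFDerivAt_phase {d : ℕ} (η : Fin d → ℝ) (lam : ℝ) (x : Fin d → ℝ) :
    HasFDerivAt (fun y : Fin d → ℝ => lam * ∑ i, y i * η i)
      (lam • ∑ i, η i • (ContinuousLinearMap.proj i : (Fin d → ℝ) →L[ℝ] ℝ)) x :=
  (HasFDerivAt.fun_sum fun i _ => (hasFDerivAt_apply i x).mul_const (η i)).const_mul lam

theorem differentiableAt_spiral {d : ℕ} {x : Fin d → ℝ} {b f g : (Fin d → ℝ) → ℝ}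
    (hb : DifferentiableAt ℝ b x) (hf : DifferentiableAt ℝ f x)
    (hg : DifferentiableAt ℝ g x) (η : Fin d → ℝ) (lam : ℝ) :
    DifferentiableAt ℝ (fun y => (1 / lam) * b y * (Real.sin (lam * ∑ i, y i * η i) * f y
      + Real.cos (lam * ∑ i, y i * η i) * g y)) x := by
  fun_prop

theorem pd_spiral {d : ℕ} {x : Fin d → ℝ} {b f g : (Fin d → ℝ) → ℝ} (i : Fin d)
    (hb : DifferentiableAt ℝ b x) (hf : DifferentiableAt ℝ f x)
    (hg : DifferentiableAt ℝ g x) (η : Fin d → ℝ) {lam : ℝ} (hlam : lam ≠ 0) :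
    pd i (fun y => (1 / lam) * b y * (Real.sin (lam * ∑ m, y m * η m) * f y
      + Real.cos (lam * ∑ m, y m * η m) * g y)) x
    = (1 / lam) * pd i b x * (Real.sin (lam * ∑ m, x m * η m) * f x
        + Real.cos (lam * ∑ m, x m * η m) * g x)
      + b x * η i * (Real.cos (lam * ∑ m, x m * η m) * f x
        - Real.sin (lam * ∑ m, x m * η m) * g x)
      + (1 / lam) * b x * (Real.sin (lam * ∑ m, x m * η m) * pd i f x
        + Real.cos (lam * ∑ m, x m * η m) * pd i g x) := by
  have hθ := hasFDerivAt_phase η lam x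
  have h := (hb.hasFDerivAt.const_mul (1 / lam)).fun_mul
    ((hθ.sin.fun_mul hf.hasFDerivAt).fun_add (hθ.cos.fun_mul hg.hasFDerivAt))
  have hval : (∑ m, η m • (ContinuousLinearMap.proj m : (Fin d → ℝ) →L[ℝ] ℝ))
      (Pi.single i 1) = η i := by
    simp [Pi.single_apply]
  simp only [pd]
  rw [h.fderiv]
  simp only [add_apply, smul_apply, hval, smul_eq_mul]
  field_simp
  ring

/-- The Gram product of two vectors perturbed in an orthonormal frame. -/
theorem sum_add_frame_mul_add_frame {k : ℕ} {E₁ E₂ : Fin k → ℝ}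
    (hE₁ : ∑ l, E₁ l ^ 2 = 1) (hE₂ : ∑ l, E₂ l ^ 2 = 1) (hE₁₂ : ∑ l, E₁ l * E₂ l = 0)
    (u u' : Fin k → ℝ) (r s r' s' : ℝ) :
    ∑ l, (u l + (r * E₁ l + s * E₂ l)) * (u' l + (r' * E₁ l + s' * E₂ l))
    = ∑ l, u l * u' l + r' * ∑ l, u l * E₁ l + s' * ∑ l, u l * E₂ l
      + r * ∑ l, u' l * E₁ l + s * ∑ l, u' l * E₂ l + r * r' + s * s' := by
  calc
    _ = ∑ l, u l * u' l + r' * ∑ l, u l * E₁ l + s' * ∑ l, u l * E₂ l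
        + r * ∑ l, u' l * E₁ l + s * ∑ l, u' l * E₂ l + r * r' * ∑ l, E₁ l ^ 2
        + s * s' * ∑ l, E₂ l ^ 2 + (r * s' + s * r') * ∑ l, E₁ l * E₂ l := by
      simp only [Finset.mul_sum, ← Finset.sum_add_distrib]
      exact Finset.sum_congr rfl fun l _ => by ring
    _ = _ := by rw [hE₁, hE₂, hE₁₂]; ring


/-- Lemma 2.3: the basic "step" construction by Nash's spirals, using a pair of
orthogonal codimension directions, with `G(t) = sin t`, `Ḡ(t) = cos t`. -/
theorem step_spiral
    {d k : ℕ} (ω : Set (Fin d → ℝ)) (hω : IsOpen ω) (hk : 2 ≤ k)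
    (v : (Fin d → ℝ) → Fin k → ℝ) (w : (Fin d → ℝ) → Fin d → ℝ)
    (hv : ContDiffOn ℝ 2 v ω) (hw : ContDiffOn ℝ 1 w ω)
    (a : (Fin d → ℝ) → ℝ) (ha : ContDiffOn ℝ 2 a ω)
    (η : Fin d → ℝ) (hη : ∑ i, η i ^ 2 = 1)
    (lam : ℝ) (hlam : 0 < lam)
    (E₁ E₂ : Fin k → ℝ)
    (hE₁ : ∑ l, E₁ l ^ 2 = 1) (hE₂ : ∑ l, E₂ l ^ 2 = 1)
    (hE₁₂ : ∑ l, E₁ l * E₂ l = 0)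
    (vt : (Fin d → ℝ) → Fin k → ℝ) (wt : (Fin d → ℝ) → Fin d → ℝ)
    (hvt : vt = fun x l => v x l
      + (1 / lam) * a x * (Real.sin (lam * ∑ i, x i * η i) * E₁ l
          + Real.cos (lam * ∑ i, x i * η i) * E₂ l))
    (hwt : wt = fun x j => w x j
      - (1 / lam) * a x
          * (Real.sin (lam * ∑ i, x i * η i) * pd j (fun y => ∑ l, v y l * E₁ l) x
            + Real.cos (lam * ∑ i, x i * η i) * pd j (fun y => ∑ l, v y l * E₂ l) x)) :
    ∀ x ∈ ω, ∀ i j : Fin d,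
      ((1/2) * gradTgrad vt x i j + symGrad wt x i j)
        - ((1/2) * gradTgrad v x i j + symGrad w x i j)
        - (1/2) * a x ^ 2 * η i * η j
      = -(a x / lam)
            * (Real.sin (lam * ∑ i', x i' * η i')
                * pd i (fun y => pd j (fun z => ∑ l, v z l * E₁ l) y) x
              + Real.cos (lam * ∑ i', x i' * η i')
                * pd i (fun y => pd j (fun z => ∑ l, v z l * E₂ l) y) x)
        + (1 / (2 * lam ^ 2)) * pd i a x * pd j a x := by
  intro x hx i j
  have hlam' : lam ≠ 0 := hlam.ne'
  have hω' := hω.mem_nhds hx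
  have hv2 : ∀ l, ContDiffAt ℝ 2 (fun y => v y l) x := contDiffAt_pi.1 (hv.contDiffAt hω')
  have hvd : ∀ l, DifferentiableAt ℝ (fun y => v y l) x :=
    fun l => (hv2 l).differentiableAt (by norm_num)
  have hwd : ∀ l, DifferentiableAt ℝ (fun y => w y l) x :=
    fun l => (contDiffAt_pi.1 (hw.contDiffAt hω') l).differentiableAt (by norm_num)
  have had : DifferentiableAt ℝ a x := (ha.contDiffAt hω').differentiableAt (by norm_num)
  have hf : ∀ E : Fin k → ℝ, ContDiffAt ℝ 2 (fun y => ∑ l, v y l * E l) x :=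
    fun E => ContDiffAt.sum fun l _ => (hv2 l).mul contDiffAt_const
  have hpd := fun (E : Fin k → ℝ) (m : Fin d) => differentiableAt_pd m (hf E)
  set S := Real.sin (lam * ∑ m, x m * η m) with hS
  set C := Real.cos (lam * ∑ m, x m * η m) with hC
  have hSC : S ^ 2 + C ^ 2 = 1 := Real.sin_sq_add_cos_sq _
  have hvt' : ∀ m l, pd m (fun y => vt y l) x = pd m (fun y => v y l) x
      + (((1 / lam) * pd m a x * S + a x * η m * C) * E₁ l
        + ((1 / lam) * pd m a x * C - a x * η m * S) * E₂ l) := by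
    intro m l
    have hc := fun c : ℝ => differentiableAt_const (𝕜 := ℝ) (x := x) c
    simp only [hvt]
    rw [pd_add m (hvd l) (differentiableAt_spiral had (hc _) (hc _) η lam),
      pd_spiral m had (hc _) (hc _) η hlam', pd_const, pd_const]
    ring
  have hwt' : ∀ m n, pd m (fun y => wt y n) x = pd m (fun y => w y n) x
      - ((1 / lam) * pd m a x * (S * pd n (fun y => ∑ l, v y l * E₁ l) x
          + C * pd n (fun y => ∑ l, v y l * E₂ l) x)
        + a x * η m * (C * pd n (fun y => ∑ l, v y l * E₁ l) x
          - S * pd n (fun y => ∑ l, v y l * E₂ l) x)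
        + (1 / lam) * a x * (S * pd m (pd n (fun y => ∑ l, v y l * E₁ l)) x
          + C * pd m (pd n (fun y => ∑ l, v y l * E₂ l)) x)) := by
    intro m n
    simp only [hwt]
    rw [pd_sub m (hwd n) (differentiableAt_spiral had (hpd E₁ n) (hpd E₂ n) η lam),
      pd_spiral m had (hpd E₁ n) (hpd E₂ n) η hlam']
  simp only [gradTgrad, symGrad, hvt', hwt',
    sum_add_frame_mul_add_frame hE₁ hE₂ hE₁₂, ← pd_sum_mul_const _ hvd]
  rw [pd_comm j i (hf E₁), pd_comm j i (hf E₂)]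
  linear_combination ((1 / (2 * lam ^ 2)) * pd i a x * pd j a x
    + (1 / 2) * a x ^ 2 * η i * η j) * hSC
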